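/- arXiv:2209.08553 — 3 statements merged into one kernel-verified Lean document; each statement's English description precedes it below -/
import Mathlib

section
/- If an n×n complex matrix S is a p-isometry for some p ∈ [1,∞] with p ≠ 2 (i.e. ‖Sξ‖_p = ‖ξ‖_p for all ξ ∈ ℂ^n), then S is a unitary permutation matrix. -/
open scoped BigOperators ENNReal
open Matrix

/-- The `ℓ^p` norm of a finitely-indexed vector (with the convention `1/∞ = 0`). -/
noncomputable def lpNorm {ι : Type*} [Fintype ι] {E : Type*} [Norm E] (p : ℝ≥0∞)
    (x : ι → E) : ℝ :=
  if p = ∞ then ⨆ i, ‖x i‖ else (∑ i, ‖x i‖ ^ p.toReal) ^ p.toReal⁻¹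

/-- The operator norm of a square complex matrix acting on `ℓ^p`. -/
noncomputable def opNorm {ι : Type*} [Fintype ι] (p : ℝ≥0∞) (A : Matrix ι ι ℂ) : ℝ :=
  sSup {r : ℝ | ∃ x : ι → ℂ, lpNorm p x = 1 ∧ r = lpNorm p (A.mulVec x)}

/-- A unitary permutation matrix: a permutation matrix whose nonzero entries are
unimodular complex numbers. -/
def IsUnitaryPermutation {n : ℕ} (S : Matrix (Fin n) (Fin n) ℂ) : Prop :=
  ∃ (σ : Equiv.Perm (Fin n)) (α : Fin n → ℂ), (∀ i, ‖α i‖ = 1) ∧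
    ∀ i j, S i j = if j = σ i then α i else 0

/-- `A` is logarithmic affine: `‖A‖_{p,p} = ‖A‖_{1,1}^{1/p} ‖A‖_{∞,∞}^{1-1/p}` for all
`p ∈ [1,∞]` (with `1/∞ = 0`). -/
def LogAffine {ι : Type*} [Fintype ι] (A : Matrix ι ι ℂ) : Prop :=
  ∀ p : ℝ≥0∞, 1 ≤ p →
    opNorm p A = opNorm 1 A ^ p.toReal⁻¹ * opNorm ⊤ A ^ (1 - p.toReal⁻¹)

/-- The circulant matrix `C(α₀,…,α_{n-1})`, whose `(i,j)` entry is `α_{j-i mod n}`. -/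
noncomputable def circulantC {n : ℕ} (α : Fin n → ℂ) : Matrix (Fin n) (Fin n) ℂ :=
  Matrix.of fun i j => α (j - i)

/-- The Hankel-type matrix `H(α₀,…,α_{n-1})`, whose `(i,j)` entry is `α_{i+j mod n}`. -/
noncomputable def hankelH {n : ℕ} (α : Fin n → ℂ) : Matrix (Fin n) (Fin n) ℂ :=
  Matrix.of fun i j => α (i + j)

theorem lpNorm_single {n : ℕ} {p : ℝ≥0∞} (hp : 1 ≤ p) (j : Fin n) (c : ℂ) :
    lpNorm p (Pi.single j c : Fin n → ℂ) = ‖c‖ := by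
  have hle : ∀ i, ‖(Pi.single j c : Fin n → ℂ) i‖ ≤ ‖c‖ := fun i => by
    by_cases hij : i = j
    · subst hij; simp
    · simp [hij]
  unfold lpNorm
  split_ifs with hpt
  · refine le_antisymm (Real.iSup_le hle (norm_nonneg c)) ?_
    simpa using le_ciSup (f := fun i => ‖(Pi.single j c : Fin n → ℂ) i‖)
      (Set.finite_range _).bddAbove j
  · have hr : p.toReal ≠ 0 := (ENNReal.toReal_pos (zero_lt_one.trans_le hp).ne' hpt).ne'
    rw [Finset.sum_eq_single j]
    · simp [Real.rpow_rpow_inv (norm_nonneg c) hr]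
    · intro i _ hij
      simp [hij, Real.zero_rpow hr]
    · simp

theorem mulVec_single_add_single_apply {n : ℕ} (S : Matrix (Fin n) (Fin n) ℂ) (j k i : Fin n)
    (c : ℂ) :
    (S.mulVec (Pi.single j 1 + Pi.single k c)) i = S i j + S i k * c := by
  simp [Matrix.mulVec_add, mul_comm]

theorem norm_single_add_single_apply {n : ℕ} {j k : Fin n} (hjk : j ≠ k) {c : ℂ} (hc : ‖c‖ = 1)
    (i : Fin n) :
    ‖(Pi.single j 1 + Pi.single k c : Fin n → ℂ) i‖ =
      (if i = j then 1 else 0) + (if i = k then 1 else 0) := by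
  by_cases hij : i = j
  · subst hij; simp [hjk]
  · by_cases hik : i = k
    · subst hik; simp [hij, hc]
    · simp [hij, hik]

/-- An `ℓ^p`-isometry each of whose columns has a nonzero entry that is alone in its row is a
unitary permutation. -/
theorem isUnitaryPermutation_of_isolated_entries {n : ℕ} {S : Matrix (Fin n) (Fin n) ℂ}
    {p : ℝ≥0∞} (hp : 1 ≤ p) (h : ∀ ξ : Fin n → ℂ, lpNorm p (S.mulVec ξ) = lpNorm p ξ)
    (f : Fin n → Fin n) (hf : ∀ j, S (f j) j ≠ 0) (hf' : ∀ j k, k ≠ j → S (f j) k = 0) :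
    IsUnitaryPermutation S := by
  have hinj : Function.Injective f := fun j k hjk => by
    by_contra hne
    exact hf j (hjk ▸ hf' k j hne)
  let e : Equiv.Perm (Fin n) := Equiv.ofBijective f (Finite.injective_iff_bijective.mp hinj)
  have hS : ∀ i j, j ≠ e.symm i → S i j = 0 := fun i j hj => by
    have := hf' (e.symm i) j hj
    rwa [show f (e.symm i) = i from e.apply_symm_apply i] at this
  refine ⟨e.symm, fun i => S i (e.symm i), fun i => ?_, fun i j => ?_⟩
  · have hcol : S.mulVec (Pi.single (e.symm i) 1) = Pi.single i (S i (e.symm i)) := by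
      ext l
      by_cases hl : l = i
      · subst hl; simp
      · have : e.symm i ≠ e.symm l := fun hh => hl (e.symm.injective hh).symm
        simp [hl, hS l _ this]
    have := h (Pi.single (e.symm i) 1)
    rwa [hcol, lpNorm_single hp, lpNorm_single hp, norm_one] at this
  · split_ifs with hj
    · rw [hj]
    · exact hS i j hj

theorem isUnitaryPermutation_of_lpNorm_top {n : ℕ} {S : Matrix (Fin n) (Fin n) ℂ}
    (h : ∀ ξ : Fin n → ℂ, lpNorm ∞ (S.mulVec ξ) = lpNorm ∞ ξ) :
    IsUnitaryPermutation S := by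
  have hcol : ∀ j, ∃ i, ‖S i j‖ = 1 := fun j => by
    have : Nonempty (Fin n) := ⟨j⟩
    obtain ⟨i, hi⟩ := exists_eq_ciSup_of_finite (f := fun i => ‖S i j‖)
    refine ⟨i, hi.trans ?_⟩
    have := h (Pi.single j 1)
    rw [lpNorm_single le_top] at this
    simpa [lpNorm] using this
  have hpair : ∀ j k, j ≠ k → ∀ c : ℂ, ‖c‖ = 1 → ∀ i, ‖S i j + S i k * c‖ ≤ 1 := by
    intro j k hjk c hc i
    have hle : lpNorm ∞ (Pi.single j 1 + Pi.single k c : Fin n → ℂ) ≤ 1 := by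
      rw [lpNorm, if_pos rfl]
      refine Real.iSup_le (fun l => ?_) zero_le_one
      rw [norm_single_add_single_apply hjk hc]
      split_ifs <;> simp_all
    rw [← h, lpNorm, if_pos rfl] at hle
    simp only [mulVec_single_add_single_apply] at hle
    exact (le_ciSup (f := fun l => ‖S l j + S l k * c‖)
      (Set.finite_range _).bddAbove i).trans hle
  choose f hf using hcol
  refine isUnitaryPermutation_of_isolated_entries le_top h f
    (fun j => norm_ne_zero_iff.mp (by simp [hf j])) fun j k hkj => ?_
  have h1 := hpair j k hkj.symm 1 (by simp) (f j)
  have h2 := hpair j k hkj.symm (-1) (by simp) (f j)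
  rw [mul_one] at h1
  rw [mul_neg_one, ← sub_eq_add_neg] at h2
  have hpar := parallelogram_law_with_norm ℝ (S (f j) j) (S (f j) k)
  rw [hf j] at hpar
  have : ‖S (f j) k‖ = 0 := by
    nlinarith [norm_nonneg (S (f j) k), norm_nonneg (S (f j) j + S (f j) k),
      norm_nonneg (S (f j) j - S (f j) k)]
  exact norm_eq_zero.mp this

theorem rpow_add_rpow_lt_add_rpow {a b q : ℝ} (ha : 0 < a) (hb : 0 < b) (hq : 1 < q) :
    a ^ q + b ^ q < (a + b) ^ q := by
  have key : ∀ x, 0 < x → x < a + b → x ^ q < x * (a + b) ^ (q - 1) := fun x hx hxs => by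
    have := Real.rpow_lt_rpow hx.le hxs (sub_pos.mpr hq)
    calc x ^ q = x * x ^ (q - 1) := by rw [Real.rpow_sub_one hx.ne']; field_simp
      _ < _ := by gcongr
  have hs : (a + b) ^ q = a * (a + b) ^ (q - 1) + b * (a + b) ^ (q - 1) := by
    rw [Real.rpow_sub_one (by positivity)]; field_simp
  linarith [key a ha (by linarith), key b hb (by linarith)]

theorem add_rpow_lt_rpow_add_rpow {a b q : ℝ} (ha : 0 < a) (hb : 0 < b) (hq : q < 1) :
    (a + b) ^ q < a ^ q + b ^ q := by
  have key : ∀ x, 0 < x → x < a + b → x * (a + b) ^ (q - 1) < x ^ q := fun x hx hxs => by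
    have := Real.rpow_lt_rpow_of_neg hx hxs (sub_neg.mpr hq)
    calc x * (a + b) ^ (q - 1) < x * x ^ (q - 1) := by gcongr
      _ = x ^ q := by rw [Real.rpow_sub_one hx.ne']; field_simp
  have hs : (a + b) ^ q = a * (a + b) ^ (q - 1) + b * (a + b) ^ (q - 1) := by
    rw [Real.rpow_sub_one (by positivity)]; field_simp
  linarith [key a ha (by linarith), key b hb (by linarith)]

theorem norm_rpow_eq_sq_rpow_half (z : ℂ) (r : ℝ) : ‖z‖ ^ r = (‖z‖ ^ 2) ^ (r / 2) := by
  rw [← Real.rpow_natCast, ← Real.rpow_mul (norm_nonneg z)]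
  congr 1
  push_cast
  ring

theorem sq_norm_add_add_sq_norm_sub (z w : ℂ) :
    (1 / 2 : ℝ) * ‖z + w‖ ^ 2 + (1 / 2 : ℝ) * ‖z - w‖ ^ 2 = ‖z‖ ^ 2 + ‖w‖ ^ 2 := by
  linarith [parallelogram_law_with_norm ℝ z w]

/-- Clarkson's inequality for complex numbers, exponent above `2`, strict form. -/
theorem clarkson_lt_of_two_lt {z w : ℂ} {r : ℝ} (hr : 2 < r) (hz : z ≠ 0) (hw : w ≠ 0) :
    2 * (‖z‖ ^ r + ‖w‖ ^ r) < ‖z + w‖ ^ r + ‖z - w‖ ^ r := by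
  have h1 := rpow_add_rpow_lt_add_rpow (a := ‖z‖ ^ 2) (b := ‖w‖ ^ 2) (q := r / 2)
    (by positivity) (by positivity) (by linarith)
  have h2 := (convexOn_rpow (p := r / 2) (by linarith)).2
    (Set.mem_Ici.mpr (sq_nonneg ‖z + w‖)) (Set.mem_Ici.mpr (sq_nonneg ‖z - w‖))
    one_half_pos.le one_half_pos.le (add_halves 1)
  simp only [smul_eq_mul, sq_norm_add_add_sq_norm_sub, ← norm_rpow_eq_sq_rpow_half] at h1 h2
  linarith

/-- Clarkson's inequality for complex numbers, exponent below `2`, strict form. -/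
theorem clarkson_lt_of_lt_two {z w : ℂ} {r : ℝ} (hr₀ : 0 ≤ r) (hr : r < 2) (hz : z ≠ 0)
    (hw : w ≠ 0) :
    ‖z + w‖ ^ r + ‖z - w‖ ^ r < 2 * (‖z‖ ^ r + ‖w‖ ^ r) := by
  have h1 := add_rpow_lt_rpow_add_rpow (a := ‖z‖ ^ 2) (b := ‖w‖ ^ 2) (q := r / 2)
    (by positivity) (by positivity) (by linarith)
  have h2 := (Real.concaveOn_rpow (p := r / 2) (by linarith) (by linarith)).2
    (Set.mem_Ici.mpr (sq_nonneg ‖z + w‖)) (Set.mem_Ici.mpr (sq_nonneg ‖z - w‖))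
    one_half_pos.le one_half_pos.le (add_halves 1)
  simp only [smul_eq_mul, sq_norm_add_add_sq_norm_sub, ← norm_rpow_eq_sq_rpow_half] at h1 h2
  linarith

theorem clarkson_eq_of_eq_zero {z w : ℂ} {r : ℝ} (hr : r ≠ 0) (hzw : z = 0 ∨ w = 0) :
    ‖z + w‖ ^ r + ‖z - w‖ ^ r = 2 * (‖z‖ ^ r + ‖w‖ ^ r) := by
  rcases hzw with rfl | rfl <;> simp [Real.zero_rpow hr] <;> ring

/-- Equality in the summed Clarkson identity with exponent other than `2` forces disjoint
supports. -/
theorem eq_zero_or_eq_zero_of_sum_clarkson_eq {ι : Type*} [Fintype ι] {a b : ι → ℂ} {r : ℝ}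
    (hr₀ : 0 < r) (hr : r ≠ 2)
    (hsum : ∑ i, (‖a i + b i‖ ^ r + ‖a i - b i‖ ^ r) = ∑ i, 2 * (‖a i‖ ^ r + ‖b i‖ ^ r)) (i : ι) :
    a i = 0 ∨ b i = 0 := by
  by_contra! hab
  rcases hr.lt_or_gt with hlt | hgt
  · refine (Finset.sum_lt_sum (fun l _ => ?_) ⟨i, Finset.mem_univ i,
      clarkson_lt_of_lt_two hr₀.le hlt hab.1 hab.2⟩).ne hsum
    by_cases hl : a l = 0 ∨ b l = 0
    · exact (clarkson_eq_of_eq_zero hr₀.ne' hl).le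
    · push Not at hl
      exact (clarkson_lt_of_lt_two hr₀.le hlt hl.1 hl.2).le
  · refine (Finset.sum_lt_sum (fun l _ => ?_) ⟨i, Finset.mem_univ i,
      clarkson_lt_of_two_lt hgt hab.1 hab.2⟩).ne' hsum
    by_cases hl : a l = 0 ∨ b l = 0
    · exact (clarkson_eq_of_eq_zero hr₀.ne' hl).ge
    · push Not at hl
      exact (clarkson_lt_of_two_lt hgt hl.1 hl.2).le

theorem sum_norm_rpow_eq_of_lpNorm_eq {ι : Type*} [Fintype ι] {p : ℝ≥0∞} (hp : 1 ≤ p)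
    (hpt : p ≠ ∞) {x y : ι → ℂ} (hxy : lpNorm p x = lpNorm p y) :
    ∑ i, ‖x i‖ ^ p.toReal = ∑ i, ‖y i‖ ^ p.toReal := by
  have hr : p.toReal ≠ 0 := (ENNReal.toReal_pos (zero_lt_one.trans_le hp).ne' hpt).ne'
  simp only [lpNorm, if_neg hpt] at hxy
  exact (Real.rpow_left_inj (by positivity) (by positivity) (inv_ne_zero hr)).mp hxy

theorem isUnitaryPermutation_of_lpNorm_of_ne_top {n : ℕ} {S : Matrix (Fin n) (Fin n) ℂ}
    {p : ℝ≥0∞} (hp : 1 ≤ p) (hp2 : p ≠ 2) (hpt : p ≠ ∞)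
    (h : ∀ ξ : Fin n → ℂ, lpNorm p (S.mulVec ξ) = lpNorm p ξ) :
    IsUnitaryPermutation S := by
  have hr : 0 < p.toReal := ENNReal.toReal_pos (zero_lt_one.trans_le hp).ne' hpt
  have hr2 : p.toReal ≠ 2 := fun hh => hp2 <| by
    rw [← ENNReal.ofReal_toReal hpt, hh]; simp
  have hcol : ∀ j, ∑ i, ‖S i j‖ ^ p.toReal = 1 := fun j => by
    have := sum_norm_rpow_eq_of_lpNorm_eq hp hpt (h (Pi.single j 1))
    rw [Finset.sum_eq_single j (f := fun i => ‖(Pi.single j 1 : Fin n → ℂ) i‖ ^ p.toReal)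
      (fun i _ hij => by simp [hij, Real.zero_rpow hr.ne']) (by simp)] at this
    simpa using this
  have hpair : ∀ j k, j ≠ k → ∀ c : ℂ, ‖c‖ = 1 →
      ∑ i, ‖S i j + S i k * c‖ ^ p.toReal = 2 := by
    intro j k hjk c hc
    have := sum_norm_rpow_eq_of_lpNorm_eq hp hpt (h (Pi.single j 1 + Pi.single k c))
    have hterm : ∀ i, ‖(Pi.single j 1 + Pi.single k c : Fin n → ℂ) i‖ ^ p.toReal =
        (if i = j then 1 else 0) + (if i = k then 1 else 0) := fun i => by
      rw [norm_single_add_single_apply hjk hc]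
      split_ifs <;> simp_all [Real.zero_rpow hr.ne']
    simp only [mulVec_single_add_single_apply, hterm, Finset.sum_add_distrib] at this
    rw [this]
    norm_num
  have hdisj : ∀ i j k, j ≠ k → S i j = 0 ∨ S i k = 0 := fun i j k hjk => by
    refine eq_zero_or_eq_zero_of_sum_clarkson_eq (a := fun i => S i j) (b := fun i => S i k)
      hr hr2 ?_ i
    have h1 := hpair j k hjk 1 (by simp)
    have h2 := hpair j k hjk (-1) (by simp)
    simp only [mul_one, mul_neg_one, ← sub_eq_add_neg] at h1 h2
    rw [Finset.sum_add_distrib, h1, h2, ← Finset.mul_sum, Finset.sum_add_distrib, hcol, hcol]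
    norm_num
  have hne : ∀ j, ∃ i, S i j ≠ 0 := fun j => by
    by_contra! hz
    simpa [hz, Real.zero_rpow hr.ne'] using hcol j
  choose f hf using hne
  exact isUnitaryPermutation_of_isolated_entries hp h f hf fun j k hkj =>
    (hdisj (f j) k j hkj).resolve_right (hf j)

theorem statement2 {n : ℕ} (S : Matrix (Fin n) (Fin n) ℂ) (p : ℝ≥0∞) (hp : 1 ≤ p)
    (hp2 : p ≠ 2) (h : ∀ ξ : Fin n → ℂ, lpNorm p (S.mulVec ξ) = lpNorm p ξ) :
    IsUnitaryPermutation S := by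
  rcases eq_or_ne p ∞ with rfl | hpt
  · exact isUnitaryPermutation_of_lpNorm_top h
  · exact isUnitaryPermutation_of_lpNorm_of_ne_top hp hp2 hpt h
end

section
/- For every n×n complex matrix A, the function f(p) = ‖A‖_{p,p} is continuous on (1,∞), and moreover lim_{p→1+} ‖A‖_{p,p} = ‖A‖_{1,1} and lim_{p→∞} ‖A‖_{p,p} = ‖A‖_{∞,∞}. -/
open scoped BigOperators ENNReal
open Matrix

open MeasureTheory hiding lpNorm in
theorem lpNorm_eq_toReal_eLpNorm_count {ι E : Type*} [Fintype ι] [MeasurableSpace ι]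
    [MeasurableSingletonClass ι] [NormedAddCommGroup E] {p : ℝ≥0∞} (hp : 1 ≤ p) (x : ι → E) :
    lpNorm p x = (eLpNorm x p Measure.count).toReal := by
  have hp0 : p ≠ 0 := (zero_lt_one.trans_le hp).ne'
  by_cases h : p = ∞
  · subst h
    rw [lpNorm, if_pos rfl, eLpNorm_exponent_top, eLpNormEssSup_count,
      ENNReal.toReal_iSup fun i => enorm_ne_top]
    simp
  · rw [lpNorm, if_neg h, eLpNorm_eq_lintegral_rpow_enorm_toReal hp0 h, lintegral_count,
      tsum_fintype, ← ENNReal.toReal_rpow, one_div, ENNReal.toReal_sum]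
    · simp [← ENNReal.toReal_rpow]
    · intro i _
      exact ENNReal.rpow_ne_top_of_nonneg ENNReal.toReal_nonneg enorm_ne_top

theorem lpNorm_eq_norm_toLp {ι E : Type*} [Fintype ι] [NormedAddCommGroup E] {p : ℝ≥0∞}
    [Fact (1 ≤ p)] (x : ι → E) : lpNorm p x = ‖WithLp.toLp p x‖ := by
  have hp : 1 ≤ p := Fact.out
  by_cases h : p = ∞
  · subst h
    rw [lpNorm, if_pos rfl, PiLp.norm_eq_ciSup]
  · rw [lpNorm, if_neg h,
      PiLp.norm_eq_sum (ENNReal.toReal_pos (zero_lt_one.trans_le hp).ne' h), one_div]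

theorem lpNorm_nonneg {ι E : Type*} [Fintype ι] [NormedAddCommGroup E] {p : ℝ≥0∞}
    (hp : 1 ≤ p) (x : ι → E) : 0 ≤ lpNorm p x := by
  have : Fact (1 ≤ p) := ⟨hp⟩
  rw [lpNorm_eq_norm_toLp]
  exact norm_nonneg _

theorem lpNorm_anti {ι E : Type*} [Fintype ι] [NormedAddCommGroup E] {p q : ℝ≥0∞}
    (hp : 1 ≤ p) (hpq : p ≤ q) (x : ι → E) : lpNorm q x ≤ lpNorm p x := by
  have : Fact (1 ≤ p) := ⟨hp⟩
  have hx (i : ι) : ‖x i‖ ≤ lpNorm p x := by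
    rw [lpNorm_eq_norm_toLp]
    exact PiLp.norm_apply_le (WithLp.toLp p x) i
  have h0 := lpNorm_nonneg hp x
  by_cases hq : q = ∞
  · rw [lpNorm, if_pos hq]
    exact Real.iSup_le hx h0
  have hp' : p ≠ ∞ := ne_top_of_le_ne_top hq hpq
  have hpr : 0 < p.toReal := ENNReal.toReal_pos (zero_lt_one.trans_le hp).ne' hp'
  have hpqr : p.toReal ≤ q.toReal := ENNReal.toReal_mono hq hpq
  have hqr : 0 < q.toReal := hpr.trans_le hpqr
  have hsum : ∑ i, ‖x i‖ ^ p.toReal = lpNorm p x ^ p.toReal := by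
    rw [lpNorm, if_neg hp', Real.rpow_inv_rpow (by positivity) hpr.ne']
  nth_rewrite 1 [lpNorm]
  rw [if_neg hq, Real.rpow_inv_le_iff_of_pos (by positivity) h0 hqr]
  have hsplit {a : ℝ} (ha : 0 ≤ a) :
      a ^ q.toReal = a ^ (q.toReal - p.toReal) * a ^ p.toReal := by
    rw [← Real.rpow_add_of_nonneg ha (sub_nonneg.2 hpqr) hpr.le, sub_add_cancel]
  rw [hsplit h0, ← hsum, Finset.mul_sum]
  refine Finset.sum_le_sum fun i _ => ?_
  rw [hsplit (norm_nonneg _)]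
  gcongr
  exact hx i

theorem inv_toReal_sub_nonneg {p q : ℝ≥0∞} (hp : 1 ≤ p) (hpq : p ≤ q) :
    0 ≤ p.toReal⁻¹ - q.toReal⁻¹ := by
  rw [← ENNReal.toReal_inv, ← ENNReal.toReal_inv, sub_nonneg]
  refine ENNReal.toReal_mono ?_ (ENNReal.inv_le_inv.2 hpq)
  exact ENNReal.inv_ne_top.2 (zero_lt_one.trans_le hp).ne'

theorem lpNorm_le_card_rpow_mul {n : ℕ} {E : Type*} [NormedAddCommGroup E] {p q : ℝ≥0∞}
    (hp : 1 ≤ p) (hpq : p ≤ q) (x : Fin n → E) :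
    lpNorm p x ≤ (n : ℝ) ^ (p.toReal⁻¹ - q.toReal⁻¹) * lpNorm q x := by
  have hq : 1 ≤ q := hp.trans hpq
  have hx : MeasureTheory.AEStronglyMeasurable x MeasureTheory.Measure.count :=
    (MeasureTheory.StronglyMeasurable.of_discrete).aestronglyMeasurable
  have hfin : MeasureTheory.eLpNorm x q MeasureTheory.Measure.count ≠ ∞ :=
    (MeasureTheory.eLpNorm_count_lt_top_of_lt fun i => enorm_lt_top).ne
  have key := MeasureTheory.eLpNorm_le_eLpNorm_mul_rpow_measure_univ hpq hx
  rw [lpNorm_eq_toReal_eLpNorm_count hp, lpNorm_eq_toReal_eLpNorm_count hq, mul_comm]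
  refine (ENNReal.toReal_mono (ENNReal.mul_ne_top hfin
    (ENNReal.rpow_ne_top_of_nonneg ?_ ?_)) key).trans_eq ?_
  · simpa using inv_toReal_sub_nonneg hp hpq
  · simp
  · rw [ENNReal.toReal_mul, ← ENNReal.toReal_rpow]
    simp

theorem lpNorm_mulVec_le {ι : Type*} [Fintype ι] {p : ℝ≥0∞} (hp : 1 ≤ p) (A : Matrix ι ι ℂ)
    (x : ι → ℂ) : lpNorm p (A.mulVec x) ≤ opNorm p A * lpNorm p x := by
  have : Fact (1 ≤ p) := ⟨hp⟩
  classical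
  have hbdd : BddAbove {r : ℝ | ∃ x : ι → ℂ, lpNorm p x = 1 ∧ r = lpNorm p (A.mulVec x)} := by
    let T := LinearMap.toContinuousLinearMap (Matrix.toLpLin p p A)
    refine ⟨‖T‖, ?_⟩
    rintro r ⟨y, hy, rfl⟩
    rw [lpNorm_eq_norm_toLp] at hy ⊢
    have hT := T.le_opNorm (WithLp.toLp p y)
    rwa [hy, mul_one] at hT
  rcases eq_or_ne x 0 with rfl | hx
  · rw [Matrix.mulVec_zero, lpNorm_eq_norm_toLp]
    simp
  have hpos : 0 < lpNorm p x := by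
    rw [lpNorm_eq_norm_toLp]
    exact norm_pos_iff.2 (by simpa using hx)
  have hsmul (y : ι → ℂ) :
      lpNorm p (((lpNorm p x)⁻¹ : ℂ) • y) = (lpNorm p x)⁻¹ * lpNorm p y := by
    rw [lpNorm_eq_norm_toLp (_ • y), WithLp.toLp_smul, norm_smul, ← lpNorm_eq_norm_toLp,
      norm_inv, Complex.norm_real, Real.norm_of_nonneg hpos.le]
  rw [← div_le_iff₀ hpos, div_eq_inv_mul, ← hsmul, ← Matrix.mulVec_smul]
  refine le_csSup hbdd ⟨_, ?_, rfl⟩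
  rw [hsmul, inv_mul_cancel₀ hpos.ne']

theorem opNorm_nonneg {ι : Type*} [Fintype ι] {p : ℝ≥0∞} (hp : 1 ≤ p) (A : Matrix ι ι ℂ) :
    0 ≤ opNorm p A := by
  refine Real.sSup_nonneg ?_
  rintro r ⟨x, -, rfl⟩
  exact lpNorm_nonneg hp _

theorem opNorm_le_card_rpow_mul {n : ℕ} {p q : ℝ≥0∞} (hp : 1 ≤ p) (hq : 1 ≤ q)
    (A : Matrix (Fin n) (Fin n) ℂ) :
    opNorm p A ≤ (n : ℝ) ^ |p.toReal⁻¹ - q.toReal⁻¹| * opNorm q A := by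
  have hA := opNorm_nonneg hq A
  refine Real.sSup_le ?_ (by positivity)
  rintro r ⟨x, hx, rfl⟩
  rcases le_total p q with h | h
  · calc lpNorm p (A.mulVec x)
        ≤ (n : ℝ) ^ (p.toReal⁻¹ - q.toReal⁻¹) * lpNorm q (A.mulVec x) :=
          lpNorm_le_card_rpow_mul hp h _
      _ ≤ (n : ℝ) ^ (p.toReal⁻¹ - q.toReal⁻¹) * (opNorm q A * 1) := by
          gcongr
          exact (lpNorm_mulVec_le hq A x).trans
            (mul_le_mul_of_nonneg_left ((lpNorm_anti hp h x).trans_eq hx) hA)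
      _ = (n : ℝ) ^ |p.toReal⁻¹ - q.toReal⁻¹| * opNorm q A := by
          rw [mul_one, abs_of_nonneg (inv_toReal_sub_nonneg hp h)]
  · calc lpNorm p (A.mulVec x)
        ≤ lpNorm q (A.mulVec x) := lpNorm_anti hq h _
      _ ≤ opNorm q A * lpNorm q x := lpNorm_mulVec_le hq A x
      _ ≤ opNorm q A * ((n : ℝ) ^ (q.toReal⁻¹ - p.toReal⁻¹) * 1) := by
          gcongr
          exact (lpNorm_le_card_rpow_mul hq h x).trans_eq (by rw [hx])
      _ = (n : ℝ) ^ |p.toReal⁻¹ - q.toReal⁻¹| * opNorm q A := by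
          rw [mul_one, abs_sub_comm, abs_of_nonneg (inv_toReal_sub_nonneg hq h), mul_comm]

theorem tendsto_opNorm {α : Type*} {l : Filter α} {n : ℕ} {p : α → ℝ≥0∞} {q : ℝ≥0∞}
    (hp : ∀ᶠ a in l, 1 ≤ p a) (hq : 1 ≤ q)
    (hpq : Filter.Tendsto (fun a => (p a).toReal⁻¹) l (nhds q.toReal⁻¹))
    (A : Matrix (Fin n) (Fin n) ℂ) :
    Filter.Tendsto (fun a => opNorm (p a) A) l (nhds (opNorm q A)) := by
  rcases Nat.eq_zero_or_pos n with rfl | hn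
  · have h0 {r : ℝ≥0∞} (hr : 1 ≤ r) : opNorm r A = 0 := by
      refine le_antisymm (Real.sSup_le ?_ le_rfl) (opNorm_nonneg hr A)
      rintro s ⟨x, -, rfl⟩
      have : Fact (1 ≤ r) := ⟨hr⟩
      rw [lpNorm_eq_norm_toLp, Subsingleton.elim (WithLp.toLp r (A.mulVec x)) 0, norm_zero]
    rw [h0 hq]
    refine tendsto_const_nhds.congr' ?_
    filter_upwards [hp] with a ha using (h0 ha).symm
  have hn' : (0 : ℝ) < n := Nat.cast_pos.2 hn
  have hd : Filter.Tendsto (fun a => |(p a).toReal⁻¹ - q.toReal⁻¹|) l (nhds 0) := by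
    simpa using (hpq.sub_const q.toReal⁻¹).abs
  have hpow : Filter.Tendsto (fun a => (n : ℝ) ^ |(p a).toReal⁻¹ - q.toReal⁻¹|) l (nhds 1) := by
    simpa using (tendsto_const_nhds (x := (n : ℝ))).rpow hd (Or.inl hn'.ne')
  have hlow : Filter.Tendsto
      (fun a => ((n : ℝ) ^ |(p a).toReal⁻¹ - q.toReal⁻¹|)⁻¹ * opNorm q A) l
      (nhds (opNorm q A)) := by
    simpa using (hpow.inv₀ one_ne_zero).mul_const (opNorm q A)
  have hup : Filter.Tendsto
      (fun a => (n : ℝ) ^ |(p a).toReal⁻¹ - q.toReal⁻¹| * opNorm q A) l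
      (nhds (opNorm q A)) := by
    simpa using hpow.mul_const (opNorm q A)
  refine tendsto_of_tendsto_of_tendsto_of_le_of_le' hlow hup ?_ ?_
  · filter_upwards [hp] with a ha
    rw [inv_mul_le_iff₀ (by positivity), abs_sub_comm]
    exact opNorm_le_card_rpow_mul hq ha A
  · filter_upwards [hp] with a ha using opNorm_le_card_rpow_mul ha hq A

theorem statement6 {n : ℕ} (A : Matrix (Fin n) (Fin n) ℂ) :
    ContinuousOn (fun p : ℝ => opNorm (ENNReal.ofReal p) A) (Set.Ioi 1) ∧
    Filter.Tendsto (fun p : ℝ => opNorm (ENNReal.ofReal p) A)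
      (nhdsWithin 1 (Set.Ioi 1)) (nhds (opNorm 1 A)) ∧
    Filter.Tendsto (fun p : ℝ => opNorm (ENNReal.ofReal p) A)
      Filter.atTop (nhds (opNorm ⊤ A)) := by
  have key {l : Filter ℝ} {r : ℝ} (hl : ∀ᶠ p in l, 1 ≤ p) (hlr : l ≤ nhds r) (hr : 1 ≤ r) :
      Filter.Tendsto (fun p : ℝ => opNorm (ENNReal.ofReal p) A) l
        (nhds (opNorm (ENNReal.ofReal r) A)) := by
    refine tendsto_opNorm (hl.mono fun p hp => ENNReal.one_le_ofReal.2 hp)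
      (ENNReal.one_le_ofReal.2 hr) ?_ A
    rw [ENNReal.toReal_ofReal (zero_le_one.trans hr)]
    refine ((tendsto_inv₀ (zero_lt_one.trans_le hr).ne').mono_left hlr).congr' ?_
    filter_upwards [hl] with p hp
    rw [ENNReal.toReal_ofReal (zero_le_one.trans hp)]
  have hmem (r : ℝ) : ∀ᶠ p in nhdsWithin r (Set.Ioi 1), (1 : ℝ) ≤ p := by
    filter_upwards [self_mem_nhdsWithin] with p hp using le_of_lt hp
  refine ⟨fun r hr => key (hmem r) nhdsWithin_le_nhds (le_of_lt hr), ?_, ?_⟩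
  · simpa using key (hmem 1) nhdsWithin_le_nhds le_rfl
  · refine tendsto_opNorm ?_ le_top ?_ A
    · filter_upwards [Filter.eventually_ge_atTop 1] with p hp using ENNReal.one_le_ofReal.2 hp
    · rw [ENNReal.toReal_top, _root_.inv_zero]
      refine tendsto_inv_atTop_zero.congr' ?_
      filter_upwards [Filter.eventually_ge_atTop 0] with p hp
      rw [ENNReal.toReal_ofReal hp]
end

section
/- Let A be an n×n complex matrix and write f(p) = ‖A‖_{p,p}. Let 1 ≤ p < q₀ < r ≤ ∞ (with the convention 1/∞ = 0). If f(q₀)^{1/p − 1/r} = f(p)^{1/q₀ − 1/r} · f(r)^{1/p − 1/q₀}, then for every q ∈ [p, r] one has f(q)^{1/p − 1/r} = f(p)^{1/q − 1/r} · f(r)^{1/p − 1/q}. In particular, if f(p) = f(q₀) = f(r), then f(q) = f(p) for every q ∈ [p, r]. -/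
open scoped BigOperators ENNReal
open Matrix

namespace LpInterpolation

open Complex Complex.HadamardThreeLines

variable {ι : Type*} [Fintype ι]

lemma toReal_inv_lt_toReal_inv {p q : ℝ≥0∞} (hp : 1 ≤ p) (hpq : p < q) :
    q.toReal⁻¹ < p.toReal⁻¹ := by
  rw [← ENNReal.toReal_inv, ← ENNReal.toReal_inv]
  exact ENNReal.toReal_strict_mono
    (ENNReal.inv_ne_top.2 (zero_lt_one.trans_le hp).ne') (ENNReal.inv_lt_inv.2 hpq)

lemma toReal_inv_le_one {p : ℝ≥0∞} (hp : 1 ≤ p) : p.toReal⁻¹ ≤ 1 := by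
  rw [← ENNReal.toReal_inv, ← ENNReal.toReal_one]
  exact ENNReal.toReal_mono ENNReal.one_ne_top (ENNReal.inv_le_one.2 hp)

lemma one_le_toReal {p : ℝ≥0∞} (hp : 1 ≤ p) (hp' : p ≠ ∞) : 1 ≤ p.toReal := by
  rw [← ENNReal.toReal_one]
  exact ENNReal.toReal_mono hp' hp

lemma lpNorm_eq_norm_toLp {p : ℝ≥0∞} (hp : 1 ≤ p) (x : ι → ℂ) :
    lpNorm p x = ‖WithLp.toLp p x‖ := by
  unfold lpNorm
  split_ifs with h
  · subst h
    rw [PiLp.norm_eq_ciSup]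
  · rw [PiLp.norm_eq_sum (zero_lt_one.trans_le (one_le_toReal hp h)), one_div]

lemma lpNorm_nonneg {p : ℝ≥0∞} (hp : 1 ≤ p) (x : ι → ℂ) : 0 ≤ lpNorm p x := by
  have : Fact (1 ≤ p) := ⟨hp⟩
  rw [lpNorm_eq_norm_toLp hp]
  exact norm_nonneg _

lemma opNorm_eq_norm {p : ℝ≥0∞} [Fact (1 ≤ p)] [DecidableEq ι] (A : Matrix ι ι ℂ) :
    opNorm p A = ‖LinearMap.toContinuousLinearMap (Matrix.toLpLin p p A)‖ := by
  have hp : 1 ≤ p := Fact.out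
  rw [← ContinuousLinearMap.sSup_sphere_eq_norm, opNorm]
  congr 1
  ext t
  simp only [Set.mem_ofPred_eq, Set.mem_image, mem_sphere_zero_iff_norm]
  constructor
  · rintro ⟨x, hx, rfl⟩
    exact ⟨WithLp.toLp p x, by rw [← lpNorm_eq_norm_toLp hp, hx],
      by simp [lpNorm_eq_norm_toLp hp, Matrix.toLpLin_toLp]⟩
  · rintro ⟨x, hx, rfl⟩
    exact ⟨WithLp.ofLp x, by rw [lpNorm_eq_norm_toLp hp, WithLp.toLp_ofLp, hx],
      by simp [lpNorm_eq_norm_toLp hp, Matrix.toLpLin_apply]⟩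

lemma opNorm_nonneg {p : ℝ≥0∞} (hp : 1 ≤ p) (A : Matrix ι ι ℂ) : 0 ≤ opNorm p A := by
  classical
  have : Fact (1 ≤ p) := ⟨hp⟩
  rw [opNorm_eq_norm]
  positivity

lemma lpNorm_mulVec_le {p : ℝ≥0∞} (hp : 1 ≤ p) (A : Matrix ι ι ℂ) (x : ι → ℂ) :
    lpNorm p (A.mulVec x) ≤ opNorm p A * lpNorm p x := by
  classical
  have : Fact (1 ≤ p) := ⟨hp⟩
  rw [opNorm_eq_norm, lpNorm_eq_norm_toLp hp, lpNorm_eq_norm_toLp hp]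
  exact (LinearMap.toContinuousLinearMap (Matrix.toLpLin p p A)).le_opNorm (WithLp.toLp p x)

lemma opNorm_eq_zero_iff {p : ℝ≥0∞} (hp : 1 ≤ p) (A : Matrix ι ι ℂ) :
    opNorm p A = 0 ↔ A = 0 := by
  classical
  have : Fact (1 ≤ p) := ⟨hp⟩
  rw [opNorm_eq_norm, norm_eq_zero]
  simp

lemma lpNorm_le_one {p : ℝ≥0∞} (hp : 1 ≤ p) {x : ι → ℂ} {a : ι → ℝ} (ha : ∀ i, 0 ≤ a i)
    (ha1 : ∑ i, a i ≤ 1) (hx : ∀ i, ‖x i‖ ≤ a i ^ p.toReal⁻¹) : lpNorm p x ≤ 1 := by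
  unfold lpNorm
  split_ifs with h
  · subst h
    exact Real.iSup_le (fun i => by simpa using hx i) zero_le_one
  · have hP : 0 < p.toReal := zero_lt_one.trans_le (one_le_toReal hp h)
    refine Real.rpow_le_one (by positivity) (le_trans (Finset.sum_le_sum fun i _ => ?_) ha1)
      (by positivity)
    calc ‖x i‖ ^ p.toReal ≤ (a i ^ p.toReal⁻¹) ^ p.toReal :=
          Real.rpow_le_rpow (norm_nonneg _) (hx i) hP.le
      _ = a i := Real.rpow_inv_rpow (ha i) hP.ne'

lemma sum_norm_mul_le_lpNorm {p : ℝ≥0∞} (hp : 1 ≤ p) {w : ι → ℂ} {b : ι → ℝ}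
    (hb : ∀ i, 0 ≤ b i) (hb1 : ∑ i, b i ≤ 1) (hw : ∀ i, ‖w i‖ ≤ b i ^ (1 - p.toReal⁻¹))
    (y : ι → ℂ) : ∑ i, ‖w i‖ * ‖y i‖ ≤ lpNorm p y := by
  refine le_trans (Finset.sum_le_sum fun i _ =>
    mul_le_mul_of_nonneg_right (hw i) (norm_nonneg (y i))) ?_
  unfold lpNorm
  split_ifs with h
  · subst h
    have hle : ∀ i, ‖y i‖ ≤ ⨆ i, ‖y i‖ := le_ciSup (Set.finite_range _).bddAbove
    calc ∑ i, b i ^ (1 - (∞ : ℝ≥0∞).toReal⁻¹) * ‖y i‖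
        ≤ ∑ i, b i * ⨆ i, ‖y i‖ := Finset.sum_le_sum fun i _ => by
          simpa using mul_le_mul_of_nonneg_left (hle i) (hb i)
      _ = (∑ i, b i) * ⨆ i, ‖y i‖ := by rw [Finset.sum_mul]
      _ ≤ ⨆ i, ‖y i‖ := mul_le_of_le_one_left (Real.iSup_nonneg fun i => norm_nonneg _) hb1
  · rcases (one_le_toReal hp h).eq_or_lt with h1 | h1
    · simp [← h1]
    · have hc := Real.HolderConjugate.conjExponent h1
      have key := Real.inner_le_Lp_mul_Lq_of_nonneg Finset.univ hc
        (f := fun i => ‖y i‖) (g := fun i => b i ^ (1 - p.toReal⁻¹))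
        (fun i _ => norm_nonneg _) (fun i _ => Real.rpow_nonneg (hb i) _)
      have hg : ∀ i, (b i ^ (1 - p.toReal⁻¹)) ^ p.toReal.conjExponent = b i := fun i => by
        rw [hc.one_sub_inv, Real.rpow_inv_rpow (hb i) hc.symm.ne_zero]
      simp only [hg, one_div] at key
      refine (Finset.sum_congr rfl fun i _ => mul_comm _ _).trans_le (key.trans ?_)
      refine mul_le_of_le_one_right (by positivity) ?_
      exact Real.rpow_le_one (Finset.sum_nonneg fun i _ => hb i) hb1
        (inv_nonneg.2 hc.symm.nonneg)

lemma norm_mul_exp_log_le {c : ℂ} {a : ℝ} (ha : 0 ≤ a) (hc : ‖c‖ ≤ 1) (h0 : a = 0 → c = 0)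
    (z : ℂ) : ‖c * exp (Real.log a * z)‖ ≤ a ^ z.re := by
  rcases ha.eq_or_lt with h | h
  · simpa [h0 h.symm] using Real.rpow_nonneg ha _
  · rw [norm_mul, norm_exp, re_ofReal_mul, ← Real.rpow_def_of_pos h]
    exact mul_le_of_le_one_left (Real.rpow_nonneg ha _) hc

lemma mul_exp_log_ofReal {c : ℂ} {a : ℝ} (ha : 0 ≤ a) (h0 : a = 0 → c = 0) (s : ℝ) :
    c * exp (Real.log a * s) = c * (a ^ s : ℝ) := by
  rcases ha.eq_or_lt with h | h
  · simp [h0 h.symm]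
  · rw [Real.rpow_def_of_pos h]
    push_cast
    rfl

lemma norm_bilinear_le {p r : ℝ≥0∞} (hp : 1 ≤ p) (hpr : p < r) (A : Matrix ι ι ℂ)
    {c d : ι → ℂ} {a b : ι → ℝ} (ha : ∀ i, 0 ≤ a i) (ha1 : ∑ i, a i ≤ 1)
    (hb : ∀ i, 0 ≤ b i) (hb1 : ∑ i, b i ≤ 1) (hc : ∀ i, ‖c i‖ ≤ 1) (hd : ∀ i, ‖d i‖ ≤ 1)
    (hac : ∀ i, a i = 0 → c i = 0) (hbd : ∀ i, b i = 0 → d i = 0) {s : ℝ}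
    (hs : s ∈ Set.Icc r.toReal⁻¹ p.toReal⁻¹) :
    ‖∑ i, (d i * (b i ^ (1 - s) : ℝ)) * A.mulVec (fun j => c j * (a j ^ s : ℝ)) i‖ ≤
      opNorm r A ^ (1 - (s - r.toReal⁻¹) / (p.toReal⁻¹ - r.toReal⁻¹)) *
        opNorm p A ^ ((s - r.toReal⁻¹) / (p.toReal⁻¹ - r.toReal⁻¹)) := by
  set x : ℂ → ι → ℂ := fun z j => c j * exp (Real.log (a j) * z) with hx
  set w : ℂ → ι → ℂ := fun z i => d i * exp (Real.log (b i) * (1 - z)) with hw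
  set F : ℂ → ℂ := fun z => ∑ i, w z i * A.mulVec (x z) i with hF
  have hxn : ∀ z j, ‖x z j‖ ≤ a j ^ z.re := fun z j =>
    norm_mul_exp_log_le (ha j) (hc j) (hac j) z
  have hwn : ∀ z i, ‖w z i‖ ≤ b i ^ (1 - z.re) := fun z i =>
    norm_mul_exp_log_le (hb i) (hd i) (hbd i) (1 - z)
  have hFs : F s = ∑ i, (d i * (b i ^ (1 - s) : ℝ)) *
      A.mulVec (fun j => c j * (a j ^ s : ℝ)) i := by
    simp only [hF, hx, hw, ← ofReal_one, ← ofReal_sub]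
    refine Finset.sum_congr rfl fun i _ => ?_
    rw [mul_exp_log_ofReal (hb i) (hbd i)]
    congr 3
    funext j
    rw [mul_exp_log_ofReal (ha j) (hac j)]
  have hdiff : Differentiable ℂ F := by
    simp only [hF, hx, hw, Matrix.mulVec, dotProduct]
    fun_prop
  have hbdry : ∀ t : ℝ≥0∞, 1 ≤ t → ∀ z ∈ re ⁻¹' {t.toReal⁻¹}, ‖F z‖ ≤ opNorm t A := by
    intro t ht z hz
    replace hz : z.re = t.toReal⁻¹ := hz
    calc ‖F z‖ ≤ ∑ i, ‖w z i‖ * ‖A.mulVec (x z) i‖ :=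
          (norm_sum_le _ _).trans_eq (Finset.sum_congr rfl fun i _ => norm_mul _ _)
      _ ≤ lpNorm t (A.mulVec (x z)) :=
          sum_norm_mul_le_lpNorm ht hb hb1 (fun i => hz ▸ hwn z i) _
      _ ≤ opNorm t A * lpNorm t (x z) := lpNorm_mulVec_le ht A _
      _ ≤ opNorm t A := mul_le_of_le_one_right (opNorm_nonneg ht A)
          (lpNorm_le_one ht ha ha1 fun i => hz ▸ hxn z i)
  have hr0 : 0 ≤ r.toReal⁻¹ := by positivity
  have hp1 := toReal_inv_le_one hp
  have hB : BddAbove ((norm ∘ F) '' verticalClosedStrip r.toReal⁻¹ p.toReal⁻¹) := by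
    refine ⟨∑ i, ∑ j, ‖A i j‖, ?_⟩
    rintro _ ⟨z, ⟨hz1, hz2⟩, rfl⟩
    refine (norm_sum_le _ _).trans (Finset.sum_le_sum fun i _ => ?_)
    have hw1 : ‖w z i‖ ≤ 1 := (hwn z i).trans (Real.rpow_le_one (hb i)
      ((Finset.single_le_sum (fun i _ => hb i) (Finset.mem_univ i)).trans hb1) (by linarith))
    rw [norm_mul]
    refine (mul_le_of_le_one_left (norm_nonneg _) hw1).trans
      ((norm_sum_le _ _).trans (Finset.sum_le_sum fun j _ => ?_))
    have hx1 : ‖x z j‖ ≤ 1 := (hxn z j).trans (Real.rpow_le_one (ha j)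
      ((Finset.single_le_sum (fun i _ => ha i) (Finset.mem_univ j)).trans ha1) (by linarith))
    rw [norm_mul]
    exact mul_le_of_le_one_right (norm_nonneg _) hx1
  have key := norm_le_interp_of_mem_verticalClosedStrip' (f := F) (z := (s : ℂ))
    (toReal_inv_lt_toReal_inv hp hpr) (by simpa [verticalClosedStrip] using hs)
    hdiff.diffContOnCl hB (hbdry r (hp.trans hpr.le)) (hbdry p hp)
  rwa [hFs, ofReal_re] at key

lemma sum_norm_div_lpNorm_rpow {q : ℝ≥0∞} (hq : 1 ≤ q) (hq' : q ≠ ∞) {y : ι → ℂ}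
    (hy : 0 < lpNorm q y) : ∑ i, (‖y i‖ / lpNorm q y) ^ q.toReal = 1 := by
  have hQ := one_le_toReal hq hq'
  have hN : lpNorm q y ^ q.toReal = ∑ i, ‖y i‖ ^ q.toReal := by
    rw [lpNorm, if_neg hq', Real.rpow_inv_rpow (by positivity) (by linarith)]
  simp_rw [Real.div_rpow (norm_nonneg _) hy.le]
  rw [← Finset.sum_div, ← hN, div_self (by positivity)]

/-- The **Riesz–Thorin theorem** for matrices acting on `ℓ^p`. -/
theorem opNorm_le_interpolation {p q r : ℝ≥0∞} (hp : 1 ≤ p) (hpq : p < q) (hqr : q < r)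
    (A : Matrix ι ι ℂ) :
    opNorm q A ≤ opNorm r A ^ (1 - (q.toReal⁻¹ - r.toReal⁻¹) / (p.toReal⁻¹ - r.toReal⁻¹)) *
        opNorm p A ^ ((q.toReal⁻¹ - r.toReal⁻¹) / (p.toReal⁻¹ - r.toReal⁻¹)) := by
  have hq : 1 ≤ q := hp.trans hpq.le
  have hr : 1 ≤ r := hq.trans hqr.le
  have hq' : q ≠ ∞ := hqr.ne_top
  have hQ : 0 < q.toReal := zero_lt_one.trans_le (one_le_toReal hq hq')
  have hBnn := mul_nonneg
    (Real.rpow_nonneg (opNorm_nonneg hr A)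
      (1 - (q.toReal⁻¹ - r.toReal⁻¹) / (p.toReal⁻¹ - r.toReal⁻¹)))
    (Real.rpow_nonneg (opNorm_nonneg hp A)
      ((q.toReal⁻¹ - r.toReal⁻¹) / (p.toReal⁻¹ - r.toReal⁻¹)))
  refine Real.sSup_le ?_ hBnn
  rintro _ ⟨x, hx, rfl⟩
  set y := A.mulVec x with hy
  have hy0 : 0 ≤ lpNorm q y := lpNorm_nonneg hq y
  rcases hy0.eq_or_lt with h0 | hpos
  · rwa [← h0]
  have hx1 := sum_norm_div_lpNorm_rpow hq hq' (y := x) (by rw [hx]; exact one_pos)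
  have hy1 := sum_norm_div_lpNorm_rpow hq hq' hpos
  simp only [hx, div_one] at hx1
  have hsign : ∀ z : ℂ, ‖z / ‖z‖‖ ≤ 1 := fun z => by
    rw [norm_div, norm_real, norm_norm]
    exact div_self_le_one _
  have key := norm_bilinear_le hp (hpq.trans hqr) A
    (a := fun j => ‖x j‖ ^ q.toReal) (b := fun i => (‖y i‖ / lpNorm q y) ^ q.toReal)
    (c := fun j => x j / ‖x j‖) (d := fun i => star (y i / ‖y i‖)) (s := q.toReal⁻¹)
    (fun j => by positivity) hx1.le (fun j => by positivity) hy1.le (fun j => hsign _)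
    (fun j => by rw [norm_star]; exact hsign _)
    (fun j hj => by
      rw [Real.rpow_eq_zero (norm_nonneg _) hQ.ne', norm_eq_zero] at hj
      simp [hj])
    (fun j hj => by
      rw [Real.rpow_eq_zero (by positivity) hQ.ne', div_eq_zero_iff, norm_eq_zero] at hj
      simp [hj.resolve_right hpos.ne'])
    ⟨(toReal_inv_lt_toReal_inv hq hqr).le, (toReal_inv_lt_toReal_inv hp hpq).le⟩
  have hxs : (fun j => x j / ‖x j‖ * ((‖x j‖ ^ q.toReal) ^ q.toReal⁻¹ : ℝ)) = x := by
    funext j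
    rw [Real.rpow_rpow_inv (norm_nonneg _) hQ.ne']
    by_cases h : x j = 0
    · simp [h]
    · exact div_mul_cancel₀ _ (by simpa using h)
  have hys : ∀ i, star (y i / ‖y i‖) *
      (((‖y i‖ / lpNorm q y) ^ q.toReal) ^ (1 - q.toReal⁻¹) : ℝ) * y i =
      (lpNorm q y * (‖y i‖ / lpNorm q y) ^ q.toReal : ℝ) := by
    intro i
    by_cases h : y i = 0
    · simp [h, Real.zero_rpow hQ.ne']
    have hyi : 0 < ‖y i‖ := norm_pos_iff.2 h
    have hyc : (‖y i‖ : ℂ) ≠ 0 := by exact_mod_cast hyi.ne'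
    have h1 : star (y i / ‖y i‖) * y i = (‖y i‖ : ℂ) := by
      rw [star_div₀, div_mul_eq_mul_div, mul_comm (star _)]
      have : (y i) * star (y i) = (‖y i‖ : ℂ) ^ 2 := Complex.mul_conj' (y i)
      rw [this]
      have h2 : star (‖y i‖ : ℂ) = ‖y i‖ := Complex.conj_ofReal _
      rw [h2]
      field_simp
    rw [mul_right_comm, h1, ← Real.rpow_mul (by positivity), mul_sub, mul_one,
      mul_inv_cancel₀ hQ.ne', Real.rpow_sub_one (by positivity), ← ofReal_mul]
    congr 1
    field_simp
  simp only [hxs, ← hy, hys] at key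
  rw [← ofReal_sum, ← Finset.mul_sum, hy1, mul_one, norm_real, Real.norm_of_nonneg hy0] at key
  exact key

theorem log_opNorm_convex {p q r : ℝ≥0∞} (hp : 1 ≤ p) (hpq : p < q) (hqr : q < r)
    {A : Matrix ι ι ℂ} (hA : A ≠ 0) :
    (p.toReal⁻¹ - r.toReal⁻¹) * Real.log (opNorm q A) ≤
      (q.toReal⁻¹ - r.toReal⁻¹) * Real.log (opNorm p A) +
        (p.toReal⁻¹ - q.toReal⁻¹) * Real.log (opNorm r A) := by
  have hpos : ∀ t : ℝ≥0∞, 1 ≤ t → 0 < opNorm t A := fun t ht =>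
    (opNorm_nonneg ht A).lt_of_ne' fun h => hA ((opNorm_eq_zero_iff ht A).1 h)
  have hq : 1 ≤ q := hp.trans hpq.le
  have hP := hpos p hp
  have hR := hpos r (hq.trans hqr.le)
  have hu : 0 < p.toReal⁻¹ - r.toReal⁻¹ :=
    sub_pos.2 (toReal_inv_lt_toReal_inv hp (hpq.trans hqr))
  have key := Real.log_le_log (hpos q hq) (opNorm_le_interpolation hp hpq hqr A)
  rw [Real.log_mul (by positivity) (by positivity), Real.log_rpow hR, Real.log_rpow hP] at key
  refine (mul_le_mul_of_nonneg_left key hu.le).trans_eq ?_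
  rw [mul_add, ← mul_assoc, ← mul_assoc, mul_sub, mul_div_cancel₀ _ hu.ne']
  ring

/-- If the Riesz–Thorin inequality is an equality at one interior exponent, then it is an
equality at every exponent in between. -/
theorem opNorm_rpow_eq_of_eq {p q₀ r : ℝ≥0∞} (hp : 1 ≤ p) (hpq : p < q₀) (hqr : q₀ < r)
    (A : Matrix ι ι ℂ)
    (h : opNorm q₀ A ^ (p.toReal⁻¹ - r.toReal⁻¹) =
      opNorm p A ^ (q₀.toReal⁻¹ - r.toReal⁻¹) * opNorm r A ^ (p.toReal⁻¹ - q₀.toReal⁻¹))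
    {q : ℝ≥0∞} (hq : p ≤ q) (hq' : q ≤ r) :
    opNorm q A ^ (p.toReal⁻¹ - r.toReal⁻¹) =
      opNorm p A ^ (q.toReal⁻¹ - r.toReal⁻¹) * opNorm r A ^ (p.toReal⁻¹ - q.toReal⁻¹) := by
  rcases hq.eq_or_lt with rfl | hq
  · simp
  rcases hq'.eq_or_lt with rfl | hq'
  · simp
  have h1q : 1 ≤ q := hp.trans hq.le
  have h1q₀ : 1 ≤ q₀ := hp.trans hpq.le
  have h1r : 1 ≤ r := h1q.trans hq'.le
  have hvs := sub_pos.2 (toReal_inv_lt_toReal_inv h1q hq')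
  have hsu := sub_pos.2 (toReal_inv_lt_toReal_inv hp hq)
  have hvs₀ := sub_pos.2 (toReal_inv_lt_toReal_inv h1q₀ hqr)
  have hs₀u := sub_pos.2 (toReal_inv_lt_toReal_inv hp hpq)
  have huv := sub_pos.2 (toReal_inv_lt_toReal_inv hp (hpq.trans hqr))
  by_cases hA : A = 0
  · rw [(opNorm_eq_zero_iff h1q A).2 hA, (opNorm_eq_zero_iff hp A).2 hA,
      Real.zero_rpow huv.ne', Real.zero_rpow hvs.ne', zero_mul]
  have hpos : ∀ t : ℝ≥0∞, 1 ≤ t → 0 < opNorm t A := fun t ht =>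
    (opNorm_nonneg ht A).lt_of_ne' fun h => hA ((opNorm_eq_zero_iff ht A).1 h)
  have hP := hpos p hp
  have hQ := hpos q h1q
  have hQ₀ := hpos q₀ h1q₀
  have hR := hpos r h1r
  have hlog := congrArg Real.log h
  rw [Real.log_mul (by positivity) (by positivity), Real.log_rpow hQ₀, Real.log_rpow hP,
    Real.log_rpow hR] at hlog
  apply Real.log_injOn_pos (Set.mem_Ioi.2 (by positivity)) (Set.mem_Ioi.2 (by positivity))
  rw [Real.log_mul (by positivity) (by positivity), Real.log_rpow hQ, Real.log_rpow hP,
    Real.log_rpow hR]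
  refine le_antisymm (log_opNorm_convex hp hq hq' hA) ?_
  rcases lt_trichotomy q q₀ with hlt | rfl | hlt
  · have key := mul_le_mul_of_nonneg_left (log_opNorm_convex h1q hlt hqr hA) huv.le
    refine le_of_mul_le_mul_left ?_ hvs₀
    linear_combination key - (q.toReal⁻¹ - r.toReal⁻¹) * hlog
  · exact hlog.ge
  · have key := mul_le_mul_of_nonneg_left (log_opNorm_convex hp hpq hlt hA) huv.le
    refine le_of_mul_le_mul_left ?_ hs₀u
    linear_combination key - (p.toReal⁻¹ - q.toReal⁻¹) * hlog

end LpInterpolation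

theorem statement7 {n : ℕ} (A : Matrix (Fin n) (Fin n) ℂ) (p q₀ r : ℝ≥0∞)
    (hp : 1 ≤ p) (hpq : p < q₀) (hqr : q₀ < r)
    (h : opNorm q₀ A ^ (p.toReal⁻¹ - r.toReal⁻¹) =
      opNorm p A ^ (q₀.toReal⁻¹ - r.toReal⁻¹) * opNorm r A ^ (p.toReal⁻¹ - q₀.toReal⁻¹)) :
    (∀ q : ℝ≥0∞, p ≤ q → q ≤ r →
      opNorm q A ^ (p.toReal⁻¹ - r.toReal⁻¹) =
        opNorm p A ^ (q.toReal⁻¹ - r.toReal⁻¹) * opNorm r A ^ (p.toReal⁻¹ - q.toReal⁻¹)) ∧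
    (opNorm p A = opNorm q₀ A → opNorm q₀ A = opNorm r A →
      ∀ q : ℝ≥0∞, p ≤ q → q ≤ r → opNorm q A = opNorm p A) := by
  have key := fun q hq hq' => LpInterpolation.opNorm_rpow_eq_of_eq hp hpq hqr A h (q := q) hq hq'
  refine ⟨key, fun h₁ h₂ q hq hq' => ?_⟩
  have h1q : 1 ≤ q := hp.trans hq
  have huv := sub_pos.2 (LpInterpolation.toReal_inv_lt_toReal_inv hp (hpq.trans hqr))
  have hvs : 0 ≤ q.toReal⁻¹ - r.toReal⁻¹ := by
    rcases hq'.eq_or_lt with rfl | hlt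
    · simp
    · exact (sub_pos.2 (LpInterpolation.toReal_inv_lt_toReal_inv h1q hlt)).le
  have hsu : 0 ≤ p.toReal⁻¹ - q.toReal⁻¹ := by
    rcases hq.eq_or_lt with rfl | hlt
    · simp
    · exact (sub_pos.2 (LpInterpolation.toReal_inv_lt_toReal_inv hp hlt)).le
  have hP := LpInterpolation.opNorm_nonneg hp A
  have hpow := key q hq hq'
  rw [← h₂, ← h₁, ← Real.rpow_add_of_nonneg hP hvs hsu, sub_add_sub_comm,
    add_comm, ← sub_add_sub_comm, sub_self, add_zero] at hpow
  exact (Real.rpow_left_inj (LpInterpolation.opNorm_nonneg h1q A) hP huv.ne').1 hpow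
end
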